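/- Let f = Φ_{i₁}^{e₁}·Φ_{i₂}^{e₂}⋯Φ_{i_k}^{e_k} ∈ ℚ[x], where i₁,…,i_k are distinct positive integers and e₁,…,e_k are positive integers. Set m = lcm(i₁,…,i_k) and ℓ = max_j e_j. Then f divides (x^m − 1)^ℓ, the polynomial (x^m − 1)^ℓ has exactly ℓ + 1 nonzero coefficients, and every nonzero multiple of f in ℚ[x] has at least ℓ + 1 nonzero coefficients. -/

import Mathlib

namespace Polynomial

theorem coeff_X_mul_derivative_sub {R : Type*} [CommRing R] (g : R[X]) (n i : ℕ) :
    (X * derivative g - C (n : R) * g).coeff i = ((i : R) - n) * g.coeff i := by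
  cases i with
  | zero => simp
  | succ i =>
    rw [coeff_sub, coeff_X_mul, coeff_derivative, coeff_C_mul]
    push_cast
    ring

theorem support_X_mul_derivative_sub {R : Type*} [CommRing R] [IsDomain R] [CharZero R]
    (g : R[X]) (n : ℕ) :
    (X * derivative g - C (n : R) * g).support = g.support.erase n := by
  ext i
  rw [mem_support_iff, coeff_X_mul_derivative_sub, mul_ne_zero_iff, sub_ne_zero, Nat.cast_injective.ne_iff,
    Finset.mem_erase, mem_support_iff]

theorem lt_card_support_of_pow_dvd {K : Type*} [Field K] [CharZero K] {p : K[X]}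
    (hX : IsCoprime p X) (hp : ¬ IsUnit p) (l : ℕ) {g : K[X]} (hg : g ≠ 0) (hd : p ^ l ∣ g) :
    l < g.support.card := by
  induction l generalizing g with
  | zero => exact Finset.card_pos.2 (nonempty_support_iff.2 hg)
  | succ l ih =>
    obtain ⟨n, hn⟩ := nonempty_support_iff.2 hg
    have hsupp := support_X_mul_derivative_sub g n
    have hne : X * derivative g - C (n : K) * g ≠ 0 := by
      intro h0
      have hmono : g = C (g.coeff n) * X ^ n := by
        ext i
        have hi := coeff_X_mul_derivative_sub g n i
        rw [h0, coeff_zero, zero_eq_mul, sub_eq_zero, Nat.cast_inj] at hi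
        rw [coeff_C_mul_X_pow]
        split_ifs with h
        · rw [h]
        · exact hi.resolve_left h
      have hpX : p ∣ X ^ n := by
        have hpg : p ∣ g := (dvd_pow_self p l.succ_ne_zero).trans hd
        rw [hmono] at hpg
        exact (isUnit_C.2 (mem_support_iff.1 hn).isUnit).dvd_mul_left.1 hpg
      exact hp (hX.pow_right.isUnit_of_dvd' dvd_rfl hpX)
    have hdvd : p ^ l ∣ X * derivative g - C (n : K) * g :=
      dvd_sub ((pow_sub_one_dvd_derivative_of_pow_dvd hd).mul_left X)
        (((pow_dvd_pow p l.le_succ).trans hd).mul_left _)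
    have hlt := ih hne hdvd
    rw [hsupp, Finset.card_erase_of_mem hn] at hlt
    omega

theorem card_support_X_pow_sub_one_pow {R : Type*} [CommRing R] [IsDomain R] [CharZero R] {m : ℕ}
    (hm : 0 < m) (l : ℕ) : (((X : R[X]) ^ m - 1) ^ l).support.card = l + 1 := by
  have hexp : ((X : R[X]) ^ m - 1) ^ l = expand R m ((X + C (-1)) ^ l) := by
    simp [sub_eq_add_neg]
  have hsupp : (((X : R[X]) ^ m - 1) ^ l).support = (Finset.range (l + 1)).image (m * ·) := by
    ext i
    rw [hexp, mem_support_iff, coeff_expand hm, Finset.mem_image]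
    constructor
    · intro h
      split_ifs at h with hi
      · refine ⟨i / m, ?_, Nat.mul_div_cancel' hi⟩
        by_contra hlt
        rw [Finset.mem_range, not_lt] at hlt
        exact h (by rw [coeff_X_add_C_pow, Nat.choose_eq_zero_of_lt hlt, Nat.cast_zero, mul_zero])
      · exact absurd rfl h
    · rintro ⟨j, hj, rfl⟩
      have hj' : j ≤ l := Nat.lt_succ_iff.1 (Finset.mem_range.1 hj)
      rw [if_pos (dvd_mul_right m j), Nat.mul_div_cancel_left j hm, coeff_X_add_C_pow]
      simp [(Nat.choose_pos hj').ne']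
  rw [hsupp, Finset.card_image_of_injective _ (mul_right_injective₀ hm.ne'), Finset.card_range]

end Polynomial

open Polynomial in
theorem sparsest_multiple_of_cyclotomic_product (k : ℕ) (hk : 0 < k)
    (idx : Fin k → ℕ) (hpos : ∀ j, 0 < idx j) (hinj : Function.Injective idx)
    (e : Fin k → ℕ) (he : ∀ j, 0 < e j)
    (f : Polynomial ℚ) (hf : f = ∏ j, (cyclotomic (idx j) ℚ) ^ (e j))
    (m : ℕ) (hm : m = Finset.univ.lcm idx)
    (ℓ : ℕ) (hℓ : ℓ = Finset.univ.sup e) :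
    f ∣ (X ^ m - 1) ^ ℓ ∧
    (((X : Polynomial ℚ) ^ m - 1) ^ ℓ).support.card = ℓ + 1 ∧
    ∀ g : Polynomial ℚ, g ≠ 0 → f ∣ g → ℓ + 1 ≤ g.support.card := by
  have hmpos : 0 < m := by
    rw [hm, Nat.pos_iff_ne_zero, Ne, Finset.lcm_eq_zero_iff]
    rintro ⟨j, -, hj⟩
    exact (hpos j).ne' hj
  refine ⟨?_, card_support_X_pow_sub_one_pow hmpos ℓ, fun g hg hfg => ?_⟩
  · rw [hf]
    refine Finset.prod_dvd_of_coprime (fun i _ j _ hij => ?_) fun j _ => ?_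
    · exact (cyclotomic.isCoprime_rat (hinj.ne hij)).pow
    · have hj : cyclotomic (idx j) ℚ ∣ X ^ m - 1 :=
        (cyclotomic.dvd_X_pow_sub_one _ ℚ).trans
          (dvd_pow_sub_one_of_dvd (hm ▸ Finset.dvd_lcm (Finset.mem_univ j)))
      exact (pow_dvd_pow_of_dvd hj _).trans
        (pow_dvd_pow _ (hℓ ▸ Finset.le_sup (Finset.mem_univ j)))
  · have : Nonempty (Fin k) := ⟨⟨0, hk⟩⟩
    obtain ⟨j, -, hj⟩ := Finset.exists_mem_eq_sup Finset.univ Finset.univ_nonempty e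
    have hX : IsCoprime (cyclotomic (idx j) ℚ) X := by
      obtain ⟨q, hq⟩ := cyclotomic.dvd_X_pow_sub_one (idx j) ℚ
      refine ⟨-q, X ^ (idx j - 1), ?_⟩
      rw [← pow_succ, Nat.sub_add_cancel (hpos j)]
      linear_combination hq
    rw [hℓ, hj]
    refine lt_card_support_of_pow_dvd hX (cyclotomic.irreducible_rat (hpos j)).not_isUnit _ hg ?_
    exact (hf ▸ Finset.dvd_prod_of_mem (fun j => cyclotomic (idx j) ℚ ^ e j)
      (Finset.mem_univ j)).trans hfg
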